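/- Let S be a conical refinement commutative monoid whose algebraic preorder is antisymmetric, which has general comparability, and in which every element is the sum of a directly finite element and a purely infinite element. Then for every a ∈ S: (1) there exists a largest purely infinite element u of S with u ≤ a; (2) this u is also the largest element s of S with s + a = a; (3) there exists a unique v ∈ S with a = u + v and u ⊥ v; (4) this v is directly finite. -/

import Mathlib

namespace PaperCDS

variable {M : Type*} [AddCommMonoid M]

/-- The algebraic preorder: `a ≤ b` iff `a + c = b` for some `c`. -/
def algLe (a b : M) : Prop := ∃ c : M, a + c = b

/-- `S` is conical if `a + b = 0` implies `a = 0` and `b = 0`. -/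
def Conical (M : Type*) [AddCommMonoid M] : Prop :=
  ∀ a b : M, a + b = 0 → a = 0 ∧ b = 0

/-- The refinement property. -/
def Refinement (M : Type*) [AddCommMonoid M] : Prop :=
  ∀ a₀ a₁ b₀ b₁ : M, a₀ + a₁ = b₀ + b₁ →
    ∃ c₀₀ c₀₁ c₁₀ c₁₁ : M,
      a₀ = c₀₀ + c₀₁ ∧ a₁ = c₁₀ + c₁₁ ∧ b₀ = c₀₀ + c₁₀ ∧ b₁ = c₀₁ + c₁₁

/-- Orthogonality: `a ⊥ b` iff the only `x` with `x ≤ a` and `x ≤ b` is `0`. -/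
def Orth (a b : M) : Prop := ∀ x : M, algLe x a → algLe x b → x = 0

/-- `X^⊥ = {s : s ⊥ x for all x ∈ X}`. -/
def perpSet (X : Set M) : Set M := {s : M | ∀ x ∈ X, Orth s x}

/-- An ideal: a nonempty subset `I` with `a + b ∈ I ↔ a ∈ I ∧ b ∈ I`. -/
def IsIdeal (I : Set M) : Prop :=
  I.Nonempty ∧ ∀ a b : M, a + b ∈ I ↔ a ∈ I ∧ b ∈ I

/-- An additive endomorphism. -/
def IsAddEndo (p : M → M) : Prop :=
  p 0 = 0 ∧ ∀ x y : M, p (x + y) = p x + p y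

/-- A projection: an additive endomorphism `p` such that every `x` can be written
`x = p x + y` with `y` orthogonal to every element of the range of `p`. -/
def IsProjection (p : M → M) : Prop :=
  IsAddEndo p ∧ ∀ x : M, ∃ y : M, x = p x + y ∧ ∀ s : M, Orth y (p s)

/-- A complementary pair of projections. -/
def ComplPair (p q : M → M) : Prop :=
  IsAddEndo p ∧ IsAddEndo q ∧
    ∀ x : M, p x + q x = x ∧ p (q x) = 0 ∧ q (p x) = 0

/-- General comparability. -/
def GenComp (M : Type*) [AddCommMonoid M] : Prop :=
  ∀ a b : M, ∃ p q : M → M, ComplPair p q ∧ algLe (p a) (p b) ∧ algLe (q b) (q a)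

/-- `S` is Boolean-valued. -/
def BoolValued (M : Type*) [AddCommMonoid M] : Prop :=
  ∀ a b : M, ∃ p q : M → M, ComplPair p q ∧ algLe (p a) (p b) ∧
    ∀ p' q' : M → M, ComplPair p' q' → algLe (p' a) (p' b) →
      ∀ x : M, algLe (p' x) (p x)

/-- Directly finite element. -/
def DirectlyFinite (c : M) : Prop := ∀ x : M, x + c = c → x = 0

/-- Purely infinite element. -/
def PurelyInfinite (c : M) : Prop := c + c = c

/-- `b` is an infimum of `X` for the algebraic preorder. -/
def IsInfOf (b : M) (X : Set M) : Prop :=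
  (∀ x ∈ X, algLe b x) ∧ ∀ y : M, (∀ x ∈ X, algLe y x) → algLe y b

/-- `b` is a supremum of `X` for the algebraic preorder. -/
def IsSupOf (b : M) (X : Set M) : Prop :=
  (∀ x ∈ X, algLe x b) ∧ ∀ y : M, (∀ x ∈ X, algLe x y) → algLe b y

/-- Antisymmetry of the algebraic preorder. -/
def Antisymm (M : Type*) [AddCommMonoid M] : Prop :=
  ∀ a b : M, algLe a b → algLe b a → a = b

/-- Axiom (M5): every element is the sum of a directly finite element and a
purely infinite element. -/
def AxiomM5 (M : Type*) [AddCommMonoid M] : Prop :=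
  ∀ a : M, ∃ x y : M, DirectlyFinite x ∧ PurelyInfinite y ∧ a = x + y

/-- Axiom (M2): every nonempty subset has an infimum. -/
def AxiomM2 (M : Type*) [AddCommMonoid M] : Prop :=
  ∀ X : Set M, X.Nonempty → ∃ b : M, IsInfOf b X

theorem algLe.trans {a b c : M} (hab : algLe a b) (hbc : algLe b c) : algLe a c := by
  obtain ⟨d, rfl⟩ := hab
  obtain ⟨e, rfl⟩ := hbc
  exact ⟨d + e, (add_assoc a d e).symm⟩

theorem algLe_add_right (a b : M) : algLe a (a + b) := ⟨b, rfl⟩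

theorem algLe_add_left (a b : M) : algLe b (a + b) := ⟨a, add_comm b a⟩

theorem algLe.map {p : M → M} (hp : IsAddEndo p) {a b : M} (h : algLe a b) :
    algLe (p a) (p b) := by
  obtain ⟨c, rfl⟩ := h
  exact ⟨p c, (hp.2 a c).symm⟩

theorem Conical.eq_zero_of_algLe (hCon : Conical M) {a : M} (h : algLe a 0) : a = 0 := by
  obtain ⟨b, hb⟩ := h
  exact (hCon a b hb).1

theorem PurelyInfinite.map {p : M → M} (hp : IsAddEndo p) {a : M} (h : PurelyInfinite a) :
    PurelyInfinite (p a) := by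
  rw [PurelyInfinite, ← hp.2, h]

theorem PurelyInfinite.add_eq_right {a b : M} (ha : PurelyInfinite a) (h : algLe a b) :
    a + b = b := by
  obtain ⟨c, rfl⟩ := h
  rw [← add_assoc, ha]

theorem PurelyInfinite.add_eq_left (hAnti : Antisymm M) {a b : M} (ha : PurelyInfinite a)
    (h : algLe b a) : a + b = a := by
  obtain ⟨c, hc⟩ := h
  refine hAnti _ _ ⟨c, ?_⟩ (algLe_add_right a b)
  rw [add_assoc, hc, ha]

theorem DirectlyFinite.of_algLe {a b : M} (hb : DirectlyFinite b) (h : algLe a b) :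
    DirectlyFinite a := by
  obtain ⟨c, rfl⟩ := h
  intro x hx
  exact hb x (by rw [← add_assoc, hx])

theorem DirectlyFinite.eq_zero_of_purelyInfinite {a b : M} (hb : DirectlyFinite b)
    (ha : PurelyInfinite a) (h : algLe a b) : a = 0 :=
  hb a (ha.add_eq_right h)

/-- In a refinement monoid, the complement of `u` orthogonal to `u` is unique. -/
theorem Refinement.orth_cancel (hRef : Refinement M) {u v w : M} (h : u + v = u + w)
    (hv : Orth u v) (hw : Orth u w) : v = w := by
  obtain ⟨c₀₀, c₀₁, c₁₀, c₁₁, h₁, h₂, h₃, h₄⟩ := hRef u v u w h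
  have h₁₀ : c₁₀ = 0 := hv _ (h₃ ▸ algLe_add_left _ _) (h₂ ▸ algLe_add_right _ _)
  have h₀₁ : c₀₁ = 0 := hw _ (h₁ ▸ algLe_add_left _ _) (h₄ ▸ algLe_add_right _ _)
  rw [h₂, h₄, h₁₀, h₀₁]

/-- Every element splits along a complementary pair into a purely infinite part and a directly
finite part. -/
theorem exists_complPair_split (hAnti : Antisymm M) (hGC : GenComp M) (hM5 : AxiomM5 M) (a : M) :
    ∃ p q : M → M, ComplPair p q ∧ PurelyInfinite (p a) ∧ DirectlyFinite (q a) := by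
  obtain ⟨x, y, hx, hy, rfl⟩ := hM5 a
  obtain ⟨p, q, hpq, hle, hge⟩ := hGC x y
  have hqx : DirectlyFinite (q x) := hx.of_algLe ⟨p x, by rw [add_comm, (hpq.2.2 x).1]⟩
  have hqy : q y = 0 := hqx.eq_zero_of_purelyInfinite (hy.map hpq.2.1) hge
  have hpy := hy.map hpq.1
  refine ⟨p, q, hpq, ?_, ?_⟩
  · rw [hpq.1.2, add_comm, hpy.add_eq_left hAnti hle]
    exact hpy
  · rwa [hpq.2.1.2, hqy, add_zero]

theorem ComplPair.orth (hCon : Conical M) {p q : M → M} (h : ComplPair p q) (a b : M) :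
    Orth (p a) (q b) := by
  intro z hzp hzq
  have hq : q z = 0 := hCon.eq_zero_of_algLe ((h.2.2 a).2.2 ▸ hzp.map h.2.1)
  have hp : p z = 0 := hCon.eq_zero_of_algLe ((h.2.2 b).2.1 ▸ hzq.map h.1)
  rw [← (h.2.2 z).1, hp, hq, add_zero]

theorem ComplPair.algLe_of_eq_zero {p q : M → M} (h : ComplPair p q) {a b : M}
    (ha : q a = 0) (hab : algLe (p a) (p b)) : algLe a (p b) := by
  have := (h.2.2 a).1
  rw [ha, add_zero] at this
  rwa [this] at hab

theorem statement10 (hCon : Conical M) (hRef : Refinement M)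
    (hAnti : Antisymm M) (hGC : GenComp M) (hM5 : AxiomM5 M) :
    ∀ a : M, ∃ u : M,
      (PurelyInfinite u ∧ algLe u a ∧
        ∀ t : M, PurelyInfinite t → algLe t a → algLe t u) ∧
      (u + a = a ∧ ∀ s : M, s + a = a → algLe s u) ∧
      (∃! v : M, a = u + v ∧ Orth u v) ∧
      (∀ v : M, a = u + v → Orth u v → DirectlyFinite v) := by
  intro a
  obtain ⟨p, q, hpq, hu, hv⟩ := exists_complPair_split hAnti hGC hM5 a
  have ha : p a + q a = a := (hpq.2.2 a).1
  have hpa : algLe (p a) a := ⟨q a, ha⟩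
  have horth : Orth (p a) (q a) := hpq.orth hCon a a
  have huniq : ∀ v : M, a = p a + v → Orth (p a) v → v = q a := fun v hav hv' =>
    hRef.orth_cancel (hav.symm.trans ha.symm) hv' horth
  refine ⟨p a, ⟨hu, hpa, fun t ht hta => ?_⟩, ⟨hu.add_eq_right hpa, fun s hs => ?_⟩,
    ⟨q a, ⟨ha.symm, horth⟩, fun v h => huniq v h.1 h.2⟩, fun v hav hv' => ?_⟩
  · exact hpq.algLe_of_eq_zero
      (hv.eq_zero_of_purelyInfinite (ht.map hpq.2.1) (hta.map hpq.2.1)) (hta.map hpq.1)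
  · exact hpq.algLe_of_eq_zero (hv _ (by rw [← hpq.2.1.2, hs]))
      (algLe.map hpq.1 ⟨a, hs⟩)
  · exact huniq v hav hv' ▸ hv

end PaperCDS
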